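/- arXiv:1901.03993 — 4 statements merged into one kernel-verified Lean document; each statement's English description precedes it below -/
import Mathlib

section
/- Let T₁, T₂, S₁, S₂ be bounded linear operators on a complex separable Hilbert space H, and suppose that S₁ is similar to T₁ and S₂ is similar to T₂, i.e., there exist bounded invertible operators X₁, X₂ on H with X₁T₁ = S₁X₁ and X₂T₂ = S₂X₂. If the pair (T₁, T₂) satisfies Property (H), then the pair (S₁, S₂) also satisfies Property (H). -/
/-- A pair `(T₁, T₂)` of bounded linear operators satisfies Property (H) if every bounded
operator `X : H₂ → H₁` such that `T₁X = XT₂` and `X = T₁Z − ZT₂` for some bounded operator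
`Z : H₂ → H₁` is necessarily the zero operator. -/
def PropertyH {H₁ H₂ : Type*} [NormedAddCommGroup H₁] [InnerProductSpace ℂ H₁]
    [NormedAddCommGroup H₂] [InnerProductSpace ℂ H₂]
    (T₁ : H₁ →L[ℂ] H₁) (T₂ : H₂ →L[ℂ] H₂) : Prop :=
  ∀ X : H₂ →L[ℂ] H₁, T₁.comp X = X.comp T₂ →
    (∃ Z : H₂ →L[ℂ] H₁, X = T₁.comp Z - Z.comp T₂) → X = 0

theorem similarity_preserves_propertyH
    {H : Type*} [NormedAddCommGroup H] [InnerProductSpace ℂ H] [CompleteSpace H]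
    [TopologicalSpace.SeparableSpace H]
    (T₁ T₂ S₁ S₂ : H →L[ℂ] H) (X₁ X₂ : H ≃L[ℂ] H)
    (h₁ : (X₁ : H →L[ℂ] H).comp T₁ = S₁.comp (X₁ : H →L[ℂ] H))
    (h₂ : (X₂ : H →L[ℂ] H).comp T₂ = S₂.comp (X₂ : H →L[ℂ] H))
    (hH : PropertyH T₁ T₂) : PropertyH S₁ S₂ := by
  have hT₁ (v : H) : T₁ (X₁.symm v) = X₁.symm (S₁ v) := by
    rw [ContinuousLinearEquiv.eq_symm_apply]
    simpa using DFunLike.congr_fun h₁ (X₁.symm v)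
  have hT₂ (v : H) : S₂ (X₂ v) = X₂ (T₂ v) := (DFunLike.congr_fun h₂ v).symm
  rintro X hX ⟨Z, hZ⟩
  have hconj : (X₁.symm : H →L[ℂ] H).comp (X.comp (X₂ : H →L[ℂ] H)) = 0 := by
    refine hH _ ?_ ⟨(X₁.symm : H →L[ℂ] H).comp (Z.comp (X₂ : H →L[ℂ] H)), ?_⟩
    · ext v
      have hv : S₁ (X (X₂ v)) = X (S₂ (X₂ v)) := DFunLike.congr_fun hX (X₂ v)
      simp [hT₁, hv, hT₂]
    · ext v
      have hv : X (X₂ v) = S₁ (Z (X₂ v)) - Z (S₂ (X₂ v)) := DFunLike.congr_fun hZ (X₂ v)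
      simp [hT₁, hv, hT₂]
  ext v
  simpa using DFunLike.congr_fun hconj (X₂.symm v)
end

section
/- Let T₁, T₂ be bounded linear operators on a complex Hilbert space H and let S₂ be a bounded right inverse of T₂, i.e., T₂S₂ = I. If lim_{n→∞} ‖T₁ⁿ‖·‖S₂ⁿ‖/n = 0, then the pair (T₁, T₂) satisfies Property (H). -/
/-- If `T` commutes past `X` and `X = TZ - ZU`, then conjugating `Z` by powers of `T` and of a
right inverse `S` of `U` adds multiples of `XS`. -/
theorem pow_mul_mul_pow_eq_add_nsmul {R : Type*} [Ring R] {T U S X Z : R}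
    (hS : U * S = 1) (hX : T * X = X * U) (hZ : X = T * Z - Z * U) (n : ℕ) :
    T ^ n * Z * S ^ n = Z + n • (X * S) := by
  induction n with
  | zero => simp
  | succ n ih =>
    have hTZ : T * Z = X + Z * U := by rw [hZ]; abel
    calc T ^ (n + 1) * Z * S ^ (n + 1) = T * (T ^ n * Z * S ^ n) * S := by
          rw [pow_succ' T, pow_succ S]; simp only [mul_assoc]
      _ = T * Z * S + n • (T * X * S * S) := by
          rw [ih]; simp only [mul_add, add_mul, mul_smul_comm, smul_mul_assoc, mul_assoc]
      _ = Z + (n + 1) • (X * S) := by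
          rw [hTZ, hX, add_mul, mul_assoc Z, mul_assoc X, hS, mul_one, mul_one, succ_nsmul]
          abel

theorem propertyH_of_norm_growth
    {H : Type*} [NormedAddCommGroup H] [InnerProductSpace ℂ H] [CompleteSpace H]
    (T₁ T₂ S₂ : H →L[ℂ] H) (hright : T₂ * S₂ = 1)
    (hlim : Filter.Tendsto (fun n : ℕ => ‖T₁ ^ n‖ * ‖S₂ ^ n‖ / (n : ℝ))
      Filter.atTop (nhds 0)) :
    PropertyH T₁ T₂ := by
  rintro X hX ⟨Z, hZ⟩
  have hXS : X * S₂ = 0 := by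
    have hbound : ∀ᶠ n : ℕ in Filter.atTop,
        ‖X * S₂‖ ≤ ‖T₁ ^ n‖ * ‖S₂ ^ n‖ / (n : ℝ) * ‖Z‖ + ‖Z‖ / (n : ℝ) := by
      filter_upwards [Filter.eventually_gt_atTop 0] with n hn
      have hn_pos : (0 : ℝ) < n := Nat.cast_pos.mpr hn
      have hpow : n • (X * S₂) = T₁ ^ n * Z * S₂ ^ n - Z :=
        eq_sub_of_add_eq' (pow_mul_mul_pow_eq_add_nsmul hright hX hZ n).symm
      have hle : n * ‖X * S₂‖ ≤ ‖T₁ ^ n‖ * ‖Z‖ * ‖S₂ ^ n‖ + ‖Z‖ := by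
        calc n * ‖X * S₂‖ = ‖T₁ ^ n * Z * S₂ ^ n - Z‖ := by
              rw [← hpow, RCLike.norm_nsmul ℂ, nsmul_eq_mul]
          _ ≤ ‖T₁ ^ n * Z * S₂ ^ n‖ + ‖Z‖ := norm_sub_le _ _
          _ ≤ ‖T₁ ^ n‖ * ‖Z‖ * ‖S₂ ^ n‖ + ‖Z‖ := by
              gcongr
              exact norm_mul₃_le
      calc ‖X * S₂‖ ≤ (‖T₁ ^ n‖ * ‖Z‖ * ‖S₂ ^ n‖ + ‖Z‖) / n := by
            rwa [le_div_iff₀' hn_pos]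
        _ = ‖T₁ ^ n‖ * ‖S₂ ^ n‖ / (n : ℝ) * ‖Z‖ + ‖Z‖ / (n : ℝ) := by ring
    have hzero := (hlim.mul_const ‖Z‖).add (tendsto_const_div_atTop_nhds_zero_nat ‖Z‖)
    rw [zero_mul, zero_add] at hzero
    exact norm_le_zero_iff.mp (ge_of_tendsto hzero hbound)
  calc X = X * T₂ * S₂ := by rw [mul_assoc, hright, mul_one]
    _ = T₁ * X * S₂ := congrArg (· * S₂) hX.symm
    _ = 0 := by rw [mul_assoc, hXS, mul_zero]
end

section
/- Let (e_k)_{k≥1} be an orthonormal basis of a complex separable Hilbert space H, let (a_k)_{k≥1} and (b_k)_{k≥1} be sequences of positive real numbers with 0 < d ≤ a_k, b_k ≤ M for all k (for some constants d, M), and let A, B be the bounded backward weighted shifts determined by Ae₁ = Be₁ = 0, Ae_{k+1} = a_k e_k, Be_{k+1} = b_k e_k for k ≥ 1. Assume that lim_{n→∞} n·(∏_{k=1}^{n} b_k)/(∏_{k=1}^{n} a_k) = ∞. Then the pair (A, B) satisfies Property (H): every bounded operator X on H with AX = XB and X = AY − YB for some bounded operator Y must be zero. -/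
open Finset Filter

section BackwardShift

variable {H : Type*} [NormedAddCommGroup H] [InnerProductSpace ℂ H]

/-- A backward weighted shift acts on coordinates by `⟪e i, A w⟫ = a i * ⟪e (i + 1), w⟫`. -/
lemma inner_backwardShift (e : HilbertBasis ℕ ℂ H) {a : ℕ → ℝ} {A : H →L[ℂ] H}
    (hA0 : A (e 0) = 0) (hA : ∀ k : ℕ, A (e (k + 1)) = (a k : ℂ) • e k) (i : ℕ) (w : H) :
    inner ℂ (e i) (A w) = (a i : ℂ) * inner ℂ (e (i + 1)) w := by
  have key : (innerSL ℂ (e i)).comp A = (a i : ℂ) • innerSL ℂ (e (i + 1)) := by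
    refine ContinuousLinearMap.ext_on (s := Set.range e)
      (Submodule.dense_iff_topologicalClosure_eq_top.mpr e.dense_span) ?_
    rintro _ ⟨j, rfl⟩
    have horth := orthonormal_iff_ite.mp e.orthonormal
    have he (k : ℕ) : ‖e k‖ = 1 := e.orthonormal.1 k
    rcases j with _ | j
    · simp [hA0, horth]
    · by_cases hij : i = j
      · subst hij
        simp [hA, he]
      · simp [hA, horth, hij]
  simpa using DFunLike.congr_fun key w

lemma inner_backwardShift_pow (e : HilbertBasis ℕ ℂ H) {a : ℕ → ℝ} {A : H →L[ℂ] H}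
    (hA0 : A (e 0) = 0) (hA : ∀ k : ℕ, A (e (k + 1)) = (a k : ℂ) • e k) (n : ℕ) (w : H) :
    inner ℂ (e 0) ((A ^ n) w) = ((∏ k ∈ range n, a k : ℝ) : ℂ) * inner ℂ (e n) w := by
  induction n generalizing w with
  | zero => simp
  | succ n ih =>
    rw [pow_succ, mul_apply_eq_comp, ih, inner_backwardShift e hA0 hA,
      prod_range_succ]
    push_cast
    ring

lemma backwardShift_pow_apply {e : ℕ → H} {b : ℕ → ℝ} {B : H →L[ℂ] H}
    (hB : ∀ k : ℕ, B (e (k + 1)) = (b k : ℂ) • e k) (m n : ℕ) :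
    (B ^ n) (e (m + n)) = ((∏ k ∈ range n, b (m + k) : ℝ) : ℂ) • e m := by
  induction n with
  | zero => simp
  | succ n ih =>
    rw [pow_succ, mul_apply_eq_comp, ← add_assoc, hB, map_smul, ih, smul_smul,
      prod_range_succ]
    push_cast
    rw [mul_comm]

end BackwardShift

section Intertwining

variable {H₁ H₂ : Type*} [NormedAddCommGroup H₁] [InnerProductSpace ℂ H₁]
  [NormedAddCommGroup H₂] [InnerProductSpace ℂ H₂]
  {A : H₁ →L[ℂ] H₁} {B : H₂ →L[ℂ] H₂} {X Z : H₂ →L[ℂ] H₁}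

lemma pow_apply_of_intertwines (h : A.comp X = X.comp B) (n : ℕ) (v : H₂) :
    (A ^ n) (X v) = X ((B ^ n) v) := by
  induction n generalizing v with
  | zero => simp
  | succ n ih =>
    have hv : A (X v) = X (B v) := DFunLike.congr_fun h v
    rw [pow_succ, mul_apply_eq_comp, hv, ih, pow_succ,
      mul_apply_eq_comp]

/-- If `X = AZ - ZB` intertwines `A` and `B`, then `A ^ (n + 1) Z = Z B ^ (n + 1) + (n + 1) X B ^ n`. -/
lemma pow_succ_apply_of_commutator (h : A.comp X = X.comp B)
    (hZ : X = A.comp Z - Z.comp B) (n : ℕ) (v : H₂) :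
    (A ^ (n + 1)) (Z v) = Z ((B ^ (n + 1)) v) + ((n : ℂ) + 1) • X ((B ^ n) v) := by
  have hcomm (v : H₂) : A (Z v) = X v + Z (B v) := by rw [hZ]; simp
  induction n with
  | zero => simp [hcomm, add_comm]
  | succ n ih =>
    have hv (w : H₂) : A (X w) = X (B w) := DFunLike.congr_fun h w
    rw [pow_succ', mul_apply_eq_comp, ih, map_add, map_smul, hcomm, hv,
      ← mul_apply_eq_comp B, ← mul_apply_eq_comp B, ← pow_succ',
      ← pow_succ']
    push_cast
    module

end Intertwining

/-- Shifting the index of a product of weights in `[d, M]` changes it by at most a constant factor. -/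
lemma exists_mul_prod_range_succ_le_prod_shift {b : ℕ → ℝ} {d M : ℝ} (hd : 0 < d)
    (hbd : ∀ k, d ≤ b k) (hbM : ∀ k, b k ≤ M) (m : ℕ) :
    ∃ c > 0, ∀ n, c * ∏ k ∈ range (n + 1), b k ≤ ∏ k ∈ range n, b (m + k) := by
  have hb (k : ℕ) : 0 < b k := hd.trans_le (hbd k)
  have hM : 0 < M := (hb 0).trans_le (hbM 0)
  have hm : 0 < ∏ k ∈ range m, b k := prod_pos fun k _ => hb k
  refine ⟨d ^ m / (M * ∏ k ∈ range m, b k), by positivity, fun n => ?_⟩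
  have hn : 0 < ∏ k ∈ range n, b k := prod_pos fun k _ => hb k
  have hsplit : (∏ k ∈ range m, b k) * ∏ k ∈ range n, b (m + k) =
      (∏ k ∈ range n, b k) * ∏ k ∈ range m, b (n + k) := by
    rw [← prod_range_add, ← prod_range_add, add_comm]
  have hpow : d ^ m ≤ ∏ k ∈ range m, b (n + k) := by
    simpa using prod_le_prod (s := range m) (f := fun _ => d) (fun _ _ => hd.le)
      fun k _ => hbd (n + k)
  rw [div_mul_eq_mul_div, div_le_iff₀ (by positivity), prod_range_succ]
  calc d ^ m * ((∏ k ∈ range n, b k) * b n)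
      ≤ (∏ k ∈ range m, b (n + k)) * ((∏ k ∈ range n, b k) * M) := by
        gcongr
        · exact mul_nonneg hn.le (hb n).le
        · exact prod_nonneg fun k _ => (hb (n + k)).le
        · exact hbM n
    _ = (∏ k ∈ range n, b (m + k)) * (M * ∏ k ∈ range m, b k) := by
        linear_combination (-M) * hsplit

/-- Indices are 0-based: the basis vector `e k` corresponds to the paper's `e_{k+1}` and
the weight `a k` to the paper's `a_{k+1}`. -/
theorem backward_shifts_propertyH
    {H : Type*} [NormedAddCommGroup H] [InnerProductSpace ℂ H] [CompleteSpace H]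
    (e : HilbertBasis ℕ ℂ H) (a b : ℕ → ℝ) (d M : ℝ) (hd : 0 < d)
    (had : ∀ k, d ≤ a k) (haM : ∀ k, a k ≤ M) (hbd : ∀ k, d ≤ b k) (hbM : ∀ k, b k ≤ M)
    (A B : H →L[ℂ] H)
    (hA0 : A (e 0) = 0) (hB0 : B (e 0) = 0)
    (hA : ∀ k : ℕ, A (e (k + 1)) = (a k : ℂ) • e k)
    (hB : ∀ k : ℕ, B (e (k + 1)) = (b k : ℂ) • e k)
    (hlim : Filter.Tendsto
      (fun n : ℕ => (n : ℝ) * ((∏ k ∈ Finset.range n, b k) / (∏ k ∈ Finset.range n, a k)))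
      Filter.atTop Filter.atTop) :
    PropertyH A B := by
  rintro X hX ⟨Z, hZ⟩
  have ha (k : ℕ) : 0 < a k := hd.trans_le (had k)
  have hb (k : ℕ) : 0 < b k := hd.trans_le (hbd k)
  have he (k : ℕ) : ‖e k‖ = 1 := e.orthonormal.1 k
  have hrow (m : ℕ) : inner ℂ (e 0) (X (e m)) = 0 := by
    by_contra hx
    set x := inner ℂ (e 0) (X (e m))
    have hx' : 0 < ‖x‖ := norm_pos_iff.mpr hx
    obtain ⟨c, hc, hcb⟩ := exists_mul_prod_range_succ_le_prod_shift hd hbd hbM m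
    have hest (n : ℕ) : ((n : ℝ) + 1) * (∏ k ∈ range n, b (m + k)) * ‖x‖ ≤
        (∏ k ∈ range (n + 1), a k) * ‖Z‖ + (∏ k ∈ range n, b (m + k)) * (‖Z‖ * ‖B‖) := by
      have hβ : 0 < ∏ k ∈ range n, b (m + k) := prod_pos fun k _ => hb _
      have hα : 0 < ∏ k ∈ range (n + 1), a k := prod_pos fun k _ => ha _
      have h := congrArg (inner ℂ (e 0)) (pow_succ_apply_of_commutator hX hZ n (e (m + n)))
      rw [inner_backwardShift_pow e hA0 hA, pow_succ', mul_apply_eq_comp,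
        backwardShift_pow_apply hB, map_smul, map_smul, map_smul, inner_add_right,
        inner_smul_right, inner_smul_right, inner_smul_right] at h
      generalize ∏ k ∈ range n, b (m + k) = β at *
      generalize ∏ k ∈ range (n + 1), a k = α at *
      have hYZ : ‖inner ℂ (e (n + 1)) (Z (e (m + n)))‖ ≤ ‖Z‖ := by
        refine (norm_inner_le_norm _ _).trans ?_
        simpa [he] using Z.le_opNorm (e (m + n))
      have hZB : ‖inner ℂ (e 0) (Z (B (e m)))‖ ≤ ‖Z‖ * ‖B‖ := by
        refine (norm_inner_le_norm _ _).trans ?_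
        rw [he, one_mul]
        refine (Z.le_opNorm _).trans ?_
        gcongr
        simpa [he] using B.le_opNorm (e m)
      have hval : ((n : ℂ) + 1) * ((β : ℂ) * x) =
          α * inner ℂ (e (n + 1)) (Z (e (m + n))) - β * inner ℂ (e 0) (Z (B (e m))) := by
        rw [h]; ring
      have hn : ‖(n : ℂ) + 1‖ = (n : ℝ) + 1 := by
        exact_mod_cast Complex.norm_natCast (n + 1)
      calc ((n : ℝ) + 1) * β * ‖x‖ = ‖((n : ℂ) + 1) * ((β : ℂ) * x)‖ := by
            rw [norm_mul, norm_mul, hn, Complex.norm_of_nonneg hβ.le, mul_assoc]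
        _ ≤ _ := by
            rw [hval]
            refine (norm_sub_le _ _).trans ?_
            rw [norm_mul, norm_mul, Complex.norm_of_nonneg hβ.le, Complex.norm_of_nonneg hα.le]
            gcongr
    have hlarge := (tendsto_natCast_atTop_atTop (R := ℝ)).eventually_ge_atTop
      (2 * (‖Z‖ * ‖B‖) / ‖x‖)
    have hratio := ((tendsto_add_atTop_iff_nat 1).mpr hlim).eventually_gt_atTop
      (2 * ‖Z‖ / (c * ‖x‖))
    obtain ⟨n, hn₁, hn₂⟩ := (hlarge.and hratio).exists
    have hα : 0 < ∏ k ∈ range (n + 1), a k := prod_pos fun k _ => ha _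
    have hβ : 0 < ∏ k ∈ range n, b (m + k) := prod_pos fun k _ => hb _
    have hest := hest n
    have hcb := hcb n
    rw [← mul_div_assoc, div_lt_div_iff₀ (by positivity) hα] at hn₂
    rw [div_le_iff₀ hx'] at hn₁
    push_cast at hn₂
    generalize ∏ k ∈ range n, b (m + k) = β at *
    generalize ∏ k ∈ range (n + 1), a k = α at *
    generalize ∏ k ∈ range (n + 1), b k = γ at *
    have h₁ : β * (2 * (‖Z‖ * ‖B‖)) ≤ β * (((n : ℝ) + 1) * ‖x‖) :=
      mul_le_mul_of_nonneg_left (by linarith) hβ.le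
    have h₂ : (((n : ℝ) + 1) * ‖x‖) * (c * γ) ≤ (((n : ℝ) + 1) * ‖x‖) * β := by gcongr
    linarith
  have hfun : (innerSL ℂ (e 0)).comp X = 0 := by
    refine ContinuousLinearMap.ext_on (s := Set.range e)
      (Submodule.dense_iff_topologicalClosure_eq_top.mpr e.dense_span) ?_
    rintro _ ⟨m, rfl⟩
    simpa using hrow m
  ext v
  refine e.repr.injective (lp.ext (funext fun i => ?_))
  have hi := inner_backwardShift_pow e hA0 hA i (X v)
  have h0 : inner ℂ (e 0) (X ((B ^ i) v)) = 0 := DFunLike.congr_fun hfun ((B ^ i) v)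
  rw [pow_apply_of_intertwines hX, h0, eq_comm, mul_eq_zero] at hi
  have hα : ((∏ k ∈ range i, a k : ℝ) : ℂ) ≠ 0 :=
    Complex.ofReal_ne_zero.mpr (prod_pos fun k _ => ha k).ne'
  simpa [e.repr_apply_apply] using hi.resolve_left hα
end

section
/- Let G be a compact self-adjoint operator on a complex separable Hilbert space H such that I + G is positive and invertible. Then there exists α ∈ (0,1) such that α·I + G is a positive operator, and its positive square root X = (α·I + G)^{1/2} satisfies X*X = α·I + G and X − √α·I is compact. -/
/-- A strictly positive element of a unital C⋆-algebra dominates a positive multiple of the unit. -/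
lemma IsStrictlyPositive.exists_pos_algebraMap_le {A : Type*} [CStarAlgebra A] [PartialOrder A]
    [StarOrderedRing A] {a : A} (ha : IsStrictlyPositive a) :
    ∃ r : ℝ, 0 < r ∧ algebraMap ℝ A r ≤ a := by
  rcases subsingleton_or_nontrivial A with _ | _
  · exact ⟨1, one_pos, (Subsingleton.elim _ _).le⟩
  · exact (CFC.exists_pos_algebraMap_le_iff ha.isSelfAdjoint).2 fun x hx ↦ ha.spectrum_pos hx

/-- If `X ≥ 0`, `c > 0` and `X² - c²` is compact, then `X - c` is compact. -/
lemma IsCompactOperator.sub_algebraMap_of_mul_self_sub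
    {H : Type*} [NormedAddCommGroup H] [InnerProductSpace ℂ H] [CompleteSpace H]
    {X : H →L[ℂ] H} (hX : 0 ≤ X) {c : ℝ} (hc : 0 < c)
    (h : IsCompactOperator ⇑(X * X - algebraMap ℝ (H →L[ℂ] H) (c * c))) :
    IsCompactOperator ⇑(X - algebraMap ℝ (H →L[ℂ] H) c) := by
  obtain ⟨u, hu⟩ : IsUnit (algebraMap ℝ (H →L[ℂ] H) c + X) :=
    ((isStrictlyPositive_algebraMap hc).add_nonneg hX).isUnit
  have hfactor : u * (X - algebraMap ℝ (H →L[ℂ] H) c) =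
      X * X - algebraMap ℝ (H →L[ℂ] H) (c * c) := by
    rw [hu, add_comm, map_mul, (Algebra.commute_algebraMap_right c X).mul_self_sub_mul_self_eq]
  rw [← u.inv_mul_cancel_left (X - algebraMap ℝ (H →L[ℂ] H) c), hfactor]
  exact h.clm_comp (↑u⁻¹ : H →L[ℂ] H)

theorem compact_perturbation_sqrt
    {H : Type*} [NormedAddCommGroup H] [InnerProductSpace ℂ H] [CompleteSpace H]
    [TopologicalSpace.SeparableSpace H]
    (G : H →L[ℂ] H) (hGsa : IsSelfAdjoint G) (hGcpt : IsCompactOperator ⇑G)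
    (hpos : ((1 : H →L[ℂ] H) + G).IsPositive) (hinv : IsUnit ((1 : H →L[ℂ] H) + G)) :
    ∃ α : ℝ, 0 < α ∧ α < 1 ∧
      ((α : ℂ) • (1 : H →L[ℂ] H) + G).IsPositive ∧
      ∃ X : H →L[ℂ] H, X.IsPositive ∧ X * X = (α : ℂ) • (1 : H →L[ℂ] H) + G ∧
        IsCompactOperator ⇑(X - ((Real.sqrt α : ℝ) : ℂ) • (1 : H →L[ℂ] H)) := by
  have hstrict : IsStrictlyPositive (1 + G) :=
    ⟨(ContinuousLinearMap.nonneg_iff_isPositive _).2 hpos, hinv⟩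
  have hsmul (t : ℝ) : (t : ℂ) • (1 : H →L[ℂ] H) = algebraMap ℝ (H →L[ℂ] H) t := by
    rw [Algebra.algebraMap_eq_smul_one, Complex.coe_smul]
  simp only [hsmul, ← ContinuousLinearMap.nonneg_iff_isPositive]
  obtain ⟨r, hr, hle⟩ := hstrict.exists_pos_algebraMap_le
  obtain ⟨α, hα, hα1, hαr⟩ : ∃ α : ℝ, 0 < α ∧ α < 1 ∧ 1 - α ≤ r :=
    ⟨max (1 - r) (1 / 2), by positivity, max_lt (by linarith) (by norm_num),
      by linarith [le_max_left (1 - r) (1 / 2)]⟩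
  have hnonneg : 0 ≤ algebraMap ℝ (H →L[ℂ] H) α + G := by
    have h : algebraMap ℝ (H →L[ℂ] H) (1 - α) ≤ 1 + G := (algebraMap_mono _ hαr).trans hle
    rw [map_sub, map_one, sub_eq_add_neg, add_le_add_iff_left] at h
    exact neg_le_iff_add_nonneg'.1 h
  obtain ⟨X, hX, hXX⟩ : ∃ X : H →L[ℂ] H, 0 ≤ X ∧ X * X = algebraMap ℝ (H →L[ℂ] H) α + G :=
    ⟨_, CFC.sqrt_nonneg _, CFC.sqrt_mul_sqrt_self _ hnonneg⟩
  refine ⟨α, hα, hα1, hnonneg, X, hX, hXX,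
    .sub_algebraMap_of_mul_self_sub hX (Real.sqrt_pos.2 hα) ?_⟩
  rwa [hXX, Real.mul_self_sqrt hα.le, add_sub_cancel_left]
end
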